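/- arXiv:2305.08207 — 5 statements merged into one kernel-verified Lean document; each statement's English description precedes it below -/
import Mathlib

section
/- Let P and Q be probability measures on a measurable space with P ≪ Q, and let g be a measurable real-valued function that is integrable with respect to P and square-integrable with respect to Q, with Var_Q(g) > 0. Then (E_P[g] − E_Q[g])² ≤ Var_Q(g) · χ²(P‖Q), where the inequality is interpreted in [0,∞] if χ²(P‖Q) is infinite. -/
open MeasureTheory

/-- The Cauchy-Schwarz inequality for the covariance. -/
theorem covariance_sq_le_variance_mul_variance {Ω : Type*} [MeasurableSpace Ω] {μ : Measure Ω}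
    [IsProbabilityMeasure μ] {X Y : Ω → ℝ} (hX : MemLp X 2 μ) (hY : MemLp Y 2 μ) :
    ProbabilityTheory.covariance X Y μ ^ 2 ≤
      ProbabilityTheory.variance X μ * ProbabilityTheory.variance Y μ := by
  have h : ∀ t : ℝ, 0 ≤ ProbabilityTheory.variance Y μ * (t * t) +
      2 * ProbabilityTheory.covariance X Y μ * t + ProbabilityTheory.variance X μ := by
    intro t
    have h0 := ProbabilityTheory.variance_nonneg (X + t • Y) μ
    rw [ProbabilityTheory.variance_add hX (hY.const_smul t), ProbabilityTheory.variance_smul,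
      ProbabilityTheory.covariance_smul_right] at h0
    linarith
  have := discrim_le_zero h
  unfold discrim at this
  linarith

/-- For probability measures `P ≪ Q` and a measurable function `g`
integrable under `P` and square-integrable under `Q` with positive variance under `Q`,
`(E_P[g] - E_Q[g])^2 ≤ Var_Q(g) * χ²(P‖Q)`, interpreted in `[0,∞]`
(the chi-square divergence is `∫ (dP/dQ)² dQ - 1`, possibly infinite). -/
theorem chiSq_variational_lower_bound {α : Type*} [MeasurableSpace α]
    (P Q : Measure α) [IsProbabilityMeasure P] [IsProbabilityMeasure Q]
    (hPQ : P ≪ Q) (g : α → ℝ) (hg : Measurable g)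
    (hgP : Integrable g P) (hgQ : Integrable g Q)
    (hg2Q : Integrable (fun x => (g x) ^ 2) Q)
    (hvar : 0 < ∫ x, (g x) ^ 2 ∂Q - (∫ x, g x ∂Q) ^ 2) :
    ENNReal.ofReal ((∫ x, g x ∂P - ∫ x, g x ∂Q) ^ 2) ≤
      ENNReal.ofReal (∫ x, (g x) ^ 2 ∂Q - (∫ x, g x ∂Q) ^ 2) *
        ((∫⁻ x, (P.rnDeriv Q x) ^ 2 ∂Q) - 1) := by
  by_cases htop : ∫⁻ x, (P.rnDeriv Q x) ^ 2 ∂Q = ⊤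
  · rw [htop, ENNReal.top_sub ENNReal.one_ne_top,
      ENNReal.mul_top (ENNReal.ofReal_pos.2 hvar).ne']
    exact le_top
  have hmeas : Measurable fun x => (P.rnDeriv Q x) ^ 2 :=
    (Measure.measurable_rnDeriv P Q).pow_const 2
  have hf : MemLp (fun x => (P.rnDeriv Q x).toReal) 2 Q := by
    rw [memLp_two_iff_integrable_sq
      (Measure.measurable_rnDeriv P Q).ennreal_toReal.aestronglyMeasurable]
    simpa using integrable_toReal_of_lintegral_ne_top hmeas.aemeasurable htop
  have hg2 : MemLp g 2 Q := (memLp_two_iff_integrable_sq hg.aestronglyMeasurable).2 hg2Q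
  have hf1 : ∫ x, (P.rnDeriv Q x).toReal ∂Q = 1 := by
    simp [Measure.integral_toReal_rnDeriv hPQ]
  have hf2 : ∫ x, (P.rnDeriv Q x).toReal ^ 2 ∂Q =
      (∫⁻ x, (P.rnDeriv Q x) ^ 2 ∂Q).toReal := by
    rw [← integral_toReal hmeas.aemeasurable (ae_lt_top hmeas htop)]
    simp
  have hfg : ∫ x, (P.rnDeriv Q x).toReal * g x ∂Q = ∫ x, g x ∂P := by
    simpa using integral_rnDeriv_smul (f := g) hPQ
  have key := covariance_sq_le_variance_mul_variance hg2 hf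
  rw [ProbabilityTheory.covariance_comm, ProbabilityTheory.covariance_eq_sub hf hg2,
    ProbabilityTheory.variance_eq_sub hg2, ProbabilityTheory.variance_eq_sub hf] at key
  simp only [Pi.mul_apply, Pi.pow_apply, hf1, hf2, hfg, one_mul, one_pow] at key
  calc
    _ ≤ _ := ENNReal.ofReal_le_ofReal key
    _ = _ := by
      rw [ENNReal.ofReal_mul hvar.le, ENNReal.ofReal_sub _ zero_le_one,
        ENNReal.ofReal_toReal htop, ENNReal.ofReal_one]
end

section
/- Let P and Q be probability measures on a measurable space with P ≪ Q, and suppose the Radon–Nikodym derivative g* = dP/dQ is square-integrable with respect to Q and χ²(P‖Q) > 0. Then g* is integrable with respect to P, Var_Q(g*) = χ²(P‖Q), and (E_P[g*] − E_Q[g*])² / Var_Q(g*) = χ²(P‖Q); in particular the supremum in the variational representation χ²(P‖Q) = sup_g (E_P[g] − E_Q[g])² / Var_Q(g) is attained at g = dP/dQ. -/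
open MeasureTheory

/-- If `P ≪ Q` are probability measures and `g* = dP/dQ` is
square-integrable under `Q` with `χ²(P‖Q) = ∫ (g*)² dQ - 1 > 0`, then `g*` is
integrable under `P`, `Var_Q(g*) = χ²(P‖Q)`, and
`(E_P[g*] - E_Q[g*])² / Var_Q(g*) = χ²(P‖Q)`, i.e. the supremum in the
variational representation of the chi-square divergence is attained at `g*`. -/
theorem chiSq_variational_sup_attained {α : Type*} [MeasurableSpace α]
    (P Q : Measure α) [IsProbabilityMeasure P] [IsProbabilityMeasure Q]
    (hPQ : P ≪ Q) (g : α → ℝ) (hg : g = fun x => (P.rnDeriv Q x).toReal)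
    (hg2Q : Integrable (fun x => (g x) ^ 2) Q)
    (hchi : 0 < ∫ x, (g x) ^ 2 ∂Q - 1) :
    Integrable g P ∧
    (∫ x, (g x) ^ 2 ∂Q - (∫ x, g x ∂Q) ^ 2 = ∫ x, (g x) ^ 2 ∂Q - 1) ∧
    ((∫ x, g x ∂P - ∫ x, g x ∂Q) ^ 2 /
        (∫ x, (g x) ^ 2 ∂Q - (∫ x, g x ∂Q) ^ 2) = ∫ x, (g x) ^ 2 ∂Q - 1) := by
  subst hg
  have hint : Integrable (fun x => (P.rnDeriv Q x).toReal) P := by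
    rw [← integrable_rnDeriv_smul_iff hPQ]
    simpa only [smul_eq_mul, ← pow_two] using hg2Q
  have hP : ∫ x, (P.rnDeriv Q x).toReal ∂P = ∫ x, (P.rnDeriv Q x).toReal ^ 2 ∂Q := by
    rw [← integral_rnDeriv_smul hPQ]
    simp only [smul_eq_mul, ← pow_two]
  have hQ : ∫ x, (P.rnDeriv Q x).toReal ∂Q = 1 := by
    rw [Measure.integral_toReal_rnDeriv hPQ, probReal_univ]
  refine ⟨hint, by rw [hQ, one_pow], ?_⟩
  simp only [hP, hQ, one_pow]
  rw [pow_two, mul_div_assoc, div_self hchi.ne', mul_one]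
end

section
/- (Data processing inequality for the chi-square divergence.) Let P and Q be probability measures on a measurable space 𝒳 with P ≪ Q, and let T : 𝒳 → 𝒴 be a measurable map into a measurable space 𝒴. Then the pushforward measures satisfy map(T, P) ≪ map(T, Q) and χ²(map(T, P) ‖ map(T, Q)) ≤ χ²(P‖Q). -/
open MeasureTheory
open scoped ENNReal

/-- The chi-square divergence `χ²(P‖Q) = ∫ (dP/dQ)² dQ - 1`, valued in `[0,∞]`. -/
noncomputable def chiSq {α : Type*} [MeasurableSpace α] (P Q : Measure α) : ℝ≥0∞ :=
  (∫⁻ x, (P.rnDeriv Q x) ^ 2 ∂Q) - 1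

theorem ENNReal.two_mul_le_add_sq (a b : ℝ≥0∞) : 2 * (a * b) ≤ a ^ 2 + b ^ 2 := by
  induction a with
  | top => simp
  | coe a =>
    induction b with
    | top => simp
    | coe b =>
      norm_cast
      rw [← mul_assoc]
      exact _root_.two_mul_le_add_sq a b

/-- If `φ` is bounded above by the Radon-Nikodym derivative of the pushforwards and is square
integrable, then its second moment is at most that of the original Radon-Nikodym derivative. -/
theorem lintegral_sq_le_of_le_rnDeriv_map {α β : Type*} [MeasurableSpace α] [MeasurableSpace β]
    {P Q : Measure α} [IsFiniteMeasure P] [IsFiniteMeasure Q] (hPQ : P ≪ Q)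
    {T : α → β} (hT : Measurable T) {φ : β → ℝ≥0∞} (hφ : Measurable φ)
    (hφ_le : ∀ y, φ y ≤ (P.map T).rnDeriv (Q.map T) y)
    (hφ_fin : ∫⁻ y, φ y ^ 2 ∂(Q.map T) ≠ ∞) :
    ∫⁻ y, φ y ^ 2 ∂(Q.map T) ≤ ∫⁻ x, P.rnDeriv Q x ^ 2 ∂Q := by
  have h_cross : ∫⁻ y, φ y ^ 2 ∂(Q.map T) ≤ ∫⁻ x, P.rnDeriv Q x * φ (T x) ∂Q := by
    calc ∫⁻ y, φ y ^ 2 ∂(Q.map T)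
        ≤ ∫⁻ y, (P.map T).rnDeriv (Q.map T) y * φ y ∂(Q.map T) := by
          refine lintegral_mono fun y => ?_
          rw [sq]
          exact mul_le_mul_left (hφ_le y) _
      _ = ∫⁻ y, φ y ∂(P.map T) := lintegral_rnDeriv_mul (hPQ.map hT) hφ.aemeasurable
      _ = ∫⁻ x, φ (T x) ∂P := lintegral_map hφ hT
      _ = ∫⁻ x, P.rnDeriv Q x * φ (T x) ∂Q :=
          (lintegral_rnDeriv_mul hPQ (hφ.comp hT).aemeasurable).symm
  refine ENNReal.le_of_add_le_add_right hφ_fin ?_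
  calc ∫⁻ y, φ y ^ 2 ∂(Q.map T) + ∫⁻ y, φ y ^ 2 ∂(Q.map T)
      ≤ 2 * ∫⁻ x, P.rnDeriv Q x * φ (T x) ∂Q := by
        rw [← two_mul]
        gcongr
    _ = ∫⁻ x, 2 * (P.rnDeriv Q x * φ (T x)) ∂Q :=
        (lintegral_const_mul _ ((P.measurable_rnDeriv Q).mul (hφ.comp hT))).symm
    _ ≤ ∫⁻ x, (P.rnDeriv Q x ^ 2 + φ (T x) ^ 2) ∂Q :=
        lintegral_mono fun x => ENNReal.two_mul_le_add_sq _ _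
    _ = ∫⁻ x, P.rnDeriv Q x ^ 2 ∂Q + ∫⁻ y, φ y ^ 2 ∂(Q.map T) := by
        rw [lintegral_add_left ((P.measurable_rnDeriv Q).pow_const 2),
          lintegral_map (hφ.pow_const 2) hT]

theorem lintegral_rnDeriv_map_sq_le {α β : Type*} [MeasurableSpace α] [MeasurableSpace β]
    {P Q : Measure α} [IsFiniteMeasure P] [IsFiniteMeasure Q] (hPQ : P ≪ Q)
    {T : α → β} (hT : Measurable T) :
    ∫⁻ y, (P.map T).rnDeriv (Q.map T) y ^ 2 ∂(Q.map T) ≤ ∫⁻ x, P.rnDeriv Q x ^ 2 ∂Q := by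
  set g := (P.map T).rnDeriv (Q.map T)
  have hg : Measurable g := (P.map T).measurable_rnDeriv (Q.map T)
  have hg_trunc (n : ℕ) : Measurable fun y => min (g y) n := hg.min measurable_const
  have h_lim : Filter.Tendsto (fun n : ℕ => ∫⁻ y, min (g y) n ^ 2 ∂(Q.map T)) Filter.atTop
      (nhds (∫⁻ y, g y ^ 2 ∂(Q.map T))) := by
    refine lintegral_tendsto_of_tendsto_of_monotone
      (fun n => ((hg_trunc n).pow_const 2).aemeasurable) (.of_forall fun y m n hmn => ?_) ?_
    · dsimp only
      gcongr
    · filter_upwards [(P.map T).rnDeriv_lt_top (Q.map T)] with y hy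
      obtain ⟨N, hN⟩ := ENNReal.exists_nat_gt hy.ne
      refine tendsto_const_nhds.congr' ?_
      filter_upwards [Filter.eventually_ge_atTop N] with n hn
      rw [min_eq_left (hN.le.trans (Nat.cast_le.mpr hn))]
  refine le_of_tendsto' h_lim fun n =>
    lintegral_sq_le_of_le_rnDeriv_map hPQ hT (hg_trunc n) (fun y => min_le_left _ _) ?_
  refine ne_top_of_le_ne_top (b := ∫⁻ _, (n : ℝ≥0∞) ^ 2 ∂(Q.map T)) ?_
    (lintegral_mono fun y => by gcongr; exact min_le_right _ _)
  rw [lintegral_const]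
  exact ENNReal.mul_ne_top (by simp) (measure_ne_top _ _)

/-- data processing inequality for the chi-square divergence:
for probability measures `P ≪ Q` and a measurable map `T`, the pushforwards satisfy
`map T P ≪ map T Q` and `χ²(map T P ‖ map T Q) ≤ χ²(P‖Q)`. -/
theorem chiSq_data_processing {α β : Type*} [MeasurableSpace α] [MeasurableSpace β]
    (P Q : Measure α) [IsProbabilityMeasure P] [IsProbabilityMeasure Q]
    (hPQ : P ≪ Q) (T : α → β) (hT : Measurable T) :
    P.map T ≪ Q.map T ∧ chiSq (P.map T) (Q.map T) ≤ chiSq P Q := by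
  exact ⟨hPQ.map hT, tsub_le_tsub_right (lintegral_rnDeriv_map_sq_le hPQ hT) 1⟩
end

section
/- (Abstract consistency criterion underlying Corollary 2.) For each N ∈ ℕ, let P_N and Q_N be probability measures on ℝ with P_N ≪ Q_N, supported on [0,∞) (the distribution of the squared estimation error of an estimator based on N samples under the true and presumed models, respectively), such that the identity x ↦ x is integrable with respect to P_N and square-integrable with respect to Q_N. Suppose that: (i) ∫ x dQ_N → 0 as N → ∞; (ii) there exists a constant C ≥ 0 with Var_{Q_N}(x) ≤ C / N² for all N; and (iii) χ²(P_N ‖ Q_N) = o(N²), i.e., N⁻² · χ²(P_N ‖ Q_N) → 0 as N → ∞. Then ∫ x dP_N → 0 as N → ∞, i.e., the estimator is MSE-consistent under the true model. -/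
open MeasureTheory Filter
open scoped ENNReal

open ProbabilityTheory in
/-- Cauchy–Schwarz inequality for the covariance. -/
lemma sq_covariance_le_variance_mul_variance {Ω : Type*} [MeasurableSpace Ω] {μ : Measure Ω}
    [IsProbabilityMeasure μ] {X Y : Ω → ℝ} (hX : MemLp X 2 μ) (hY : MemLp Y 2 μ) :
    cov[X, Y; μ] ^ 2 ≤ Var[X; μ] * Var[Y; μ] := by
  have h : ∀ t : ℝ, 0 ≤ Var[X; μ] * (t * t) + 2 * cov[X, Y; μ] * t + Var[Y; μ] := fun t ↦ by
    have h1 := variance_add (hX.const_smul t) hY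
    rw [variance_smul, covariance_smul_left] at h1
    linarith [variance_nonneg (t • X + Y) μ]
  have := discrim_le_zero h
  rw [discrim] at this
  linarith

section ChiSquare

variable {α : Type*} [MeasurableSpace α] {P Q : Measure α}

lemma lintegral_rnDeriv_sq_lt_top (hchi : chiSq P Q < ⊤) :
    ∫⁻ x, (P.rnDeriv Q x) ^ 2 ∂Q < ⊤ := by
  by_contra! h
  rw [chiSq, top_le_iff.mp h, ENNReal.top_sub ENNReal.one_ne_top] at hchi
  exact hchi.false

lemma lintegral_ofReal_toReal_rnDeriv_sq [SigmaFinite P] :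
    ∫⁻ x, ENNReal.ofReal ((P.rnDeriv Q x).toReal ^ 2) ∂Q = ∫⁻ x, (P.rnDeriv Q x) ^ 2 ∂Q := by
  refine lintegral_congr_ae ?_
  filter_upwards [P.rnDeriv_lt_top Q] with x hx
  rw [ENNReal.ofReal_pow ENNReal.toReal_nonneg, ENNReal.ofReal_toReal hx.ne]

lemma memLp_two_toReal_rnDeriv [SigmaFinite P] (hchi : chiSq P Q < ⊤) :
    MemLp (fun x ↦ (P.rnDeriv Q x).toReal) 2 Q := by
  have hm : Measurable fun x ↦ (P.rnDeriv Q x).toReal :=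
    (P.measurable_rnDeriv Q).ennreal_toReal
  rw [memLp_two_iff_integrable_sq hm.aestronglyMeasurable]
  refine ⟨(hm.pow_const 2).aestronglyMeasurable, ?_⟩
  rw [hasFiniteIntegral_iff_ofReal (ae_of_all _ fun x ↦ sq_nonneg _),
    lintegral_ofReal_toReal_rnDeriv_sq]
  exact lintegral_rnDeriv_sq_lt_top hchi

/-- The variance of the density of `P` under `Q` is at most `χ²(P‖Q)`. -/
lemma variance_toReal_rnDeriv_le_chiSq [IsProbabilityMeasure P]
    [IsProbabilityMeasure Q] (hPQ : P ≪ Q) (hchi : chiSq P Q < ⊤) :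
    ProbabilityTheory.variance (fun x ↦ (P.rnDeriv Q x).toReal) Q ≤ (chiSq P Q).toReal := by
  have hm : Measurable fun x ↦ (P.rnDeriv Q x).toReal :=
    (P.measurable_rnDeriv Q).ennreal_toReal
  rw [ProbabilityTheory.variance_eq_sub (memLp_two_toReal_rnDeriv hchi),
    Measure.integral_toReal_rnDeriv hPQ]
  have h2 : ∫ x, (P.rnDeriv Q x).toReal ^ 2 ∂Q = (∫⁻ x, (P.rnDeriv Q x) ^ 2 ∂Q).toReal := by
    rw [integral_eq_lintegral_of_nonneg_ae (ae_of_all _ fun x ↦ sq_nonneg _)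
      (hm.pow_const 2).aestronglyMeasurable, lintegral_ofReal_toReal_rnDeriv_sq]
  have h3 := ENNReal.le_toReal_sub (a := ∫⁻ x, (P.rnDeriv Q x) ^ 2 ∂Q) ENNReal.one_ne_top
  simpa [chiSq, h2] using h3

/-- The Hammersley–Chapman–Robbins inequality
`(E_P[g] - E_Q[g])² ≤ χ²(P‖Q) * Var_Q(g)`. -/
lemma sq_integral_sub_integral_le_chiSq_mul_variance [IsProbabilityMeasure P]
    [IsProbabilityMeasure Q] (hPQ : P ≪ Q) (hchi : chiSq P Q < ⊤)
    {g : α → ℝ} (hg : MemLp g 2 Q) :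
    (∫ x, g x ∂P - ∫ x, g x ∂Q) ^ 2
      ≤ (chiSq P Q).toReal * ProbabilityTheory.variance g Q := by
  have hr := memLp_two_toReal_rnDeriv hchi
  have hcov : ProbabilityTheory.covariance (fun x ↦ (P.rnDeriv Q x).toReal) g Q
      = ∫ x, g x ∂P - ∫ x, g x ∂Q := by
    rw [ProbabilityTheory.covariance_eq_sub hr hg, Measure.integral_toReal_rnDeriv hPQ,
      ← integral_rnDeriv_smul hPQ (f := g)]
    simp
  rw [← hcov]
  exact (sq_covariance_le_variance_mul_variance hr hg).trans
    (mul_le_mul_of_nonneg_right (variance_toReal_rnDeriv_le_chiSq hPQ hchi)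
      (ProbabilityTheory.variance_nonneg g Q))

end ChiSquare

/-- abstract consistency criterion underlying Corollary 2:
let `P_N ≪ Q_N` be probability measures on `ℝ` supported on `[0,∞)` (squared-error
distributions under the true and presumed models) with the identity integrable under
`P_N` and square-integrable under `Q_N`. If (i) `∫ x dQ_N → 0`, (ii) there is `C ≥ 0`
with `Var_{Q_N}(x) ≤ C/N²` for all `N ≥ 1`, and (iii) `χ²(P_N‖Q_N)` is finite with
`χ²(P_N‖Q_N) = o(N²)`, then `∫ x dP_N → 0`, i.e. the estimator is MSE-consistent. -/
theorem mse_consistency_of_chiSq_little_o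
    (P Q : ℕ → Measure ℝ)
    [∀ N, IsProbabilityMeasure (P N)] [∀ N, IsProbabilityMeasure (Q N)]
    (hPQ : ∀ N, P N ≪ Q N)
    (hPsupp : ∀ N, P N (Set.Iio 0) = 0) (hQsupp : ∀ N, Q N (Set.Iio 0) = 0)
    (hintP : ∀ N, Integrable (fun x => x) (P N))
    (hintQ : ∀ N, Integrable (fun x => x) (Q N))
    (hintQ2 : ∀ N, Integrable (fun x => x ^ 2) (Q N))
    (hmseQ : Tendsto (fun N => ∫ x, x ∂(Q N)) atTop (nhds 0))
    (C : ℝ) (hC : 0 ≤ C)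
    (hvar : ∀ N, 1 ≤ N →
      (∫ x, x ^ 2 ∂(Q N)) - (∫ x, x ∂(Q N)) ^ 2 ≤ C / (N : ℝ) ^ 2)
    (hchifin : ∀ N, chiSq (P N) (Q N) < ⊤)
    (hchi : Tendsto (fun N => (chiSq (P N) (Q N)).toReal / (N : ℝ) ^ 2) atTop (nhds 0)) :
    Tendsto (fun N => ∫ x, x ∂(P N)) atTop (nhds 0) := by
  have hbound : ∀ᶠ N in atTop, |∫ x, x ∂(P N) - ∫ x, x ∂(Q N)|
      ≤ √(C * ((chiSq (P N) (Q N)).toReal / (N : ℝ) ^ 2)) := by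
    filter_upwards [eventually_ge_atTop 1] with N hN
    have hmem : MemLp (fun x : ℝ ↦ x) 2 (Q N) :=
      (memLp_two_iff_integrable_sq measurable_id.aestronglyMeasurable).mpr (hintQ2 N)
    have hvarN : ProbabilityTheory.variance (fun x : ℝ ↦ x) (Q N) ≤ C / (N : ℝ) ^ 2 := by
      rw [ProbabilityTheory.variance_eq_sub hmem]
      exact hvar N hN
    refine Real.abs_le_sqrt ?_
    calc (∫ x, x ∂(P N) - ∫ x, x ∂(Q N)) ^ 2
        ≤ (chiSq (P N) (Q N)).toReal * ProbabilityTheory.variance (fun x : ℝ ↦ x) (Q N) :=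
          sq_integral_sub_integral_le_chiSq_mul_variance (hPQ N) (hchifin N) hmem
      _ ≤ (chiSq (P N) (Q N)).toReal * (C / (N : ℝ) ^ 2) :=
          mul_le_mul_of_nonneg_left hvarN ENNReal.toReal_nonneg
      _ = C * ((chiSq (P N) (Q N)).toReal / (N : ℝ) ^ 2) := by ring
  have hlim : Tendsto (fun N ↦ √(C * ((chiSq (P N) (Q N)).toReal / (N : ℝ) ^ 2)))
      atTop (nhds 0) := by
    simpa using (hchi.const_mul C).sqrt
  have hdiff : Tendsto (fun N ↦ ∫ x, x ∂(P N) - ∫ x, x ∂(Q N)) atTop (nhds 0) :=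
    squeeze_zero_norm' hbound hlim
  simpa using hdiff.add hmseQ
end

section
/- (Algebraic instantiation of Theorem 1 for centered Gaussians, Eq. (18).) Let σ_P, σ_Q > 0 with γ = σ_Q / σ_P satisfying γ² > 1/2. Then |σ_P² − σ_Q²| ≤ √2 · σ_Q² · √(γ² / √(2γ² − 1) − 1). Equivalently, for P = N(0, σ_P²) and Q = N(0, σ_Q²), the mean of x under P lies within Δ = √(Var_Q(x) · χ²(P‖Q)) of the mean of x under Q. -/
/-- algebraic instantiation of Theorem 1 for centered Gaussians,
Eq. (18): for `σ_P, σ_Q > 0` with `γ = σ_Q/σ_P` satisfying `γ² > 1/2`,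
`|σ_P² - σ_Q²| ≤ √2 · σ_Q² · √(γ²/√(2γ² - 1) - 1)`; i.e. the mean of `x` under
`N(0,σ_P²)` lies within `Δ = √(Var_Q(x²) · χ²)` of the mean under `N(0,σ_Q²)`. -/
theorem gaussian_bilateral_bound_algebraic (σP σQ : ℝ) (hσP : 0 < σP) (hσQ : 0 < σQ)
    (γ : ℝ) (hγ : γ = σQ / σP) (hγ2 : 1 / 2 < γ ^ 2) :
    |σP ^ 2 - σQ ^ 2| ≤
      Real.sqrt 2 * σQ ^ 2 * Real.sqrt (γ ^ 2 / Real.sqrt (2 * γ ^ 2 - 1) - 1) := by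
  set s := Real.sqrt (2 * γ ^ 2 - 1) with hs
  have hs0 : 0 < s := Real.sqrt_pos.mpr (by linarith)
  have hs2 : s ^ 2 = 2 * γ ^ 2 - 1 := Real.sq_sqrt (by linarith)
  have hγs : γ ^ 2 = (s ^ 2 + 1) / 2 := by linarith
  have hQ : σQ ^ 2 = (s ^ 2 + 1) / 2 * σP ^ 2 := by
    rw [← hγs, hγ]
    field_simp
  have hrhs : Real.sqrt 2 * σQ ^ 2 * Real.sqrt (γ ^ 2 / s - 1) =
      Real.sqrt (2 * (σQ ^ 2) ^ 2 * (γ ^ 2 / s - 1)) := by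
    rw [Real.sqrt_mul (by positivity), Real.sqrt_mul (by positivity),
      Real.sqrt_sq (by positivity)]
  rw [hrhs]
  apply Real.abs_le_sqrt
  rw [hQ, hγs, ← sub_nonneg]
  have key : 2 * ((s ^ 2 + 1) / 2 * σP ^ 2) ^ 2 * ((s ^ 2 + 1) / 2 / s - 1) -
      (σP ^ 2 - (s ^ 2 + 1) / 2 * σP ^ 2) ^ 2 =
      σP ^ 4 * ((s - 1) ^ 2) ^ 2 * (s ^ 2 + s + 1) / (4 * s) := by
    field_simp
    ring
  rw [key]
  positivity
end
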